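/- arXiv:2509.24937 — 2 statements merged into one kernel-verified Lean document; each statement's English description precedes it below -/
import Mathlib

section
/- Let n ≥ 1 be an integer. Then there exists a real number B > 0 such that the following holds for every finite field F with |F| > B. Let α₁, …, αₙ be nonzero elements of F and let β₁, …, βₙ ∈ F, and assume that αᵢβⱼ − αⱼβᵢ ≠ 0 for all i ≠ j. Define for each 1 ≤ i ≤ n the affine linear form Lᵢ(X) = αᵢX + βᵢ. Then for all nonzero ε₁, …, εₙ ∈ F there exist μ ∈ F and nonzero z₁, …, zₙ ∈ F such that Lᵢ(μ) = εᵢ · zᵢ² for all 1 ≤ i ≤ n. -/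
open Polynomial in
theorem Polynomial.pow_sub_dvd_hasseDeriv_pow_mul {R : Type*} [CommRing R] (f h : R[X]) (N k : ℕ) :
    f ^ (N - k) ∣ hasseDeriv k (f ^ N * h) := by
  induction N generalizing k with
  | zero => simp
  | succ N ih =>
    rw [pow_succ', mul_assoc, hasseDeriv_mul]
    refine Finset.dvd_sum fun ij hij => ?_
    obtain ⟨i, j⟩ := ij
    replace hij : i + j = k := by simpa using hij
    dsimp only
    rcases Nat.eq_zero_or_pos i with rfl | hi
    · rw [hasseDeriv_zero']
      refine (pow_dvd_pow f (show N + 1 - k ≤ N - j + 1 by omega)).trans ?_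
      rw [pow_succ']
      exact mul_dvd_mul_left f (ih j)
    · exact ((pow_dvd_pow f (by omega)).trans (ih j)).mul_left _

open Polynomial in
/-- The `k`-th Hasse derivative of `f ^ N * r` is `f ^ (N - k)` times a polynomial that depends
linearly on `r`. -/
theorem Polynomial.exists_linearMap_hasseDeriv_pow_mul {F : Type*} [Field F] {f : F[X]}
    (hf : f ≠ 0) {N k : ℕ} (hk : k ≤ N) :
    ∃ T : F[X] →ₗ[F] F[X], (∀ r, hasseDeriv k (f ^ N * r) = f ^ (N - k) * T r) ∧
      ∀ r, (T r).natDegree ≤ k * f.natDegree + r.natDegree := by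
  choose T hT using fun r => pow_sub_dvd_hasseDeriv_pow_mul f r N k
  have h0 : f ^ (N - k) ≠ 0 := pow_ne_zero _ hf
  refine ⟨{ toFun := T, map_add' := fun x y => ?_, map_smul' := fun c x => ?_ }, hT, fun r => ?_⟩
  · apply mul_left_cancel₀ h0
    rw [mul_add, ← hT, ← hT, ← hT, mul_add, map_add]
  · apply mul_left_cancel₀ h0
    rw [RingHom.id_apply, mul_smul_comm, ← hT, ← hT, mul_smul_comm, map_smul]
  · change (T r).natDegree ≤ _
    rcases eq_or_ne (T r) 0 with h | h
    · simp [h]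
    have h1 := natDegree_hasseDeriv_le (f ^ N * r) k
    have h2 : (f ^ N * r).natDegree ≤ N * f.natDegree + r.natDegree :=
      natDegree_mul_le.trans (by rw [natDegree_pow])
    rw [hT, natDegree_mul h0 h, natDegree_pow] at h1
    obtain ⟨l, rfl⟩ := Nat.exists_eq_add_of_le hk
    rw [Nat.add_sub_cancel_left, add_mul] at *
    omega

open Polynomial in
theorem Polynomial.X_sub_C_pow_dvd_of_eval_hasseDeriv {R : Type*} [CommRing R] {P : R[X]} {x : R}
    {M : ℕ} (h : ∀ k < M, (hasseDeriv k P).eval x = 0) : (X - C x) ^ M ∣ P := by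
  rw [X_sub_C_pow_dvd_iff, ← taylor_apply, X_pow_dvd_iff]
  intro k hk
  rw [taylor_coeff, h k hk]

open Polynomial in
theorem Polynomial.card_mul_le_natDegree_of_X_sub_C_pow_dvd {F : Type*} [Field F] {P : F[X]}
    (hP : P ≠ 0) (A : Finset F) (M : ℕ) (h : ∀ x ∈ A, (X - C x) ^ M ∣ P) :
    A.card * M ≤ P.natDegree := by
  have hd : ∏ x ∈ A, (X - C x) ^ M ∣ P := by
    refine Finset.prod_dvd_of_coprime (fun x _ y _ hxy => ?_) h
    exact (pairwise_coprime_X_sub_C (s := id) Function.injective_id hxy).pow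
  refine le_trans (le_of_eq ?_) (natDegree_le_of_dvd hd hP)
  rw [natDegree_prod _ _ fun x _ => pow_ne_zero _ (X_sub_C_ne_zero x)]
  simp

open Polynomial in
theorem FiniteField.polynomial_sub_pow_card {F : Type*} [Field F] [Fintype F] (P Q : F[X]) :
    (P - Q) ^ Fintype.card F = P ^ Fintype.card F - Q ^ Fintype.card F := by
  obtain ⟨n, hp, hn⟩ := FiniteField.card F (ringChar F)
  have : Fact (ringChar F).Prime := ⟨hp⟩
  rw [hn, sub_pow_char_pow]

open Polynomial in
theorem FiniteField.polynomial_sub_C_pow_card {F : Type*} [Field F] [Fintype F] (P : F[X]) (b : F) :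
    (P - C b) ^ Fintype.card F = P ^ Fintype.card F - C b := by
  rw [polynomial_sub_pow_card, ← C_pow, FiniteField.pow_card]

open Polynomial in
theorem FiniteField.eq_zero_of_X_sub_C_pow_card_dvd {F : Type*} [Field F] [Fintype F] {f r s : F[X]}
    {a c : F} {g : ℕ} (hg : 2 * g + 1 = Fintype.card F) (ha : f.rootMultiplicity a = 1)
    (hc : f.eval c ≠ 0) (hr : 2 * r.natDegree + f.natDegree < Fintype.card F)
    (hs : 2 * s.natDegree < Fintype.card F)
    (h : (X - C c) ^ Fintype.card F ∣ r + s * f ^ g) : r = 0 ∧ s = 0 := by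
  have hf : f ≠ 0 := by rintro rfl; simp at hc
  have hb : (C (f.eval c) : F[X]) ≠ 0 := C_ne_zero.mpr hc
  have hd : (X - C c) ^ Fintype.card F ∣ r ^ 2 * f - s ^ 2 * C (f.eval c) := by
    have h1 : (X - C c) ^ Fintype.card F ∣ f ^ Fintype.card F - C (f.eval c) := by
      rw [← polynomial_sub_C_pow_card]
      exact pow_dvd_pow_of_dvd (X_sub_C_dvd_sub_C_eval) _
    have h2 : r ^ 2 * f - s ^ 2 * C (f.eval c) =
        (r + s * f ^ g) * ((r - s * f ^ g) * f) +
          (f ^ Fintype.card F - C (f.eval c)) * s ^ 2 := by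
      rw [← hg]; ring
    rw [h2]
    exact dvd_add (h.mul_right _) (h1.mul_right _)
  have hz : r ^ 2 * f = s ^ 2 * C (f.eval c) := by
    rw [← sub_eq_zero]
    refine eq_zero_of_dvd_of_natDegree_lt hd ?_
    rw [natDegree_pow, natDegree_X_sub_C, mul_one]
    refine (natDegree_sub_le _ _).trans_lt (max_lt ?_ ?_)
    · refine natDegree_mul_le.trans_lt ?_
      rwa [natDegree_pow]
    · refine natDegree_mul_le.trans_lt ?_
      rwa [natDegree_pow, natDegree_C, add_zero]
  have hs0 : s = 0 := by
    by_contra hs0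
    have hr0 : r ≠ 0 := by
      rintro rfl
      simp_all
    have h3 := congrArg (rootMultiplicity a) hz
    rw [rootMultiplicity_mul (mul_ne_zero (pow_ne_zero _ hr0) hf),
      rootMultiplicity_mul (mul_ne_zero (pow_ne_zero _ hs0) hb), pow_two, pow_two,
      rootMultiplicity_mul (mul_ne_zero hr0 hr0), rootMultiplicity_mul (mul_ne_zero hs0 hs0),
      rootMultiplicity_C, ha] at h3
    omega
  refine ⟨?_, hs0⟩
  simpa [hs0, hf] using hz

open Polynomial in
theorem FiniteField.eq_zero_of_sum_mul_X_sub_C_pow_eq_zero {F : Type*} [Field F] [Fintype F]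
    {f : F[X]} {a c : F} {g : ℕ} (hg : 2 * g + 1 = Fintype.card F) (ha : f.rootMultiplicity a = 1)
    (hc : f.eval c ≠ 0) (J : ℕ) (r s : Fin J → F[X])
    (hr : ∀ j, 2 * (r j).natDegree + f.natDegree < Fintype.card F)
    (hs : ∀ j, 2 * (s j).natDegree < Fintype.card F)
    (h : ∑ j, (r j + s j * f ^ g) * ((X - C c) ^ Fintype.card F) ^ (j : ℕ) = 0) :
    ∀ j, r j = 0 ∧ s j = 0 := by
  induction J with
  | zero => exact fun j => j.elim0
  | succ J ih =>
    have hY : (X - C c) ^ Fintype.card F ≠ 0 := pow_ne_zero _ (X_sub_C_ne_zero c)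
    have hsplit : (r 0 + s 0 * f ^ g) + (X - C c) ^ Fintype.card F *
        ∑ j : Fin J, (r j.succ + s j.succ * f ^ g) *
          ((X - C c) ^ Fintype.card F) ^ (j : ℕ) = 0 := by
      rw [← h, Fin.sum_univ_succ, Finset.mul_sum]
      congr 1
      · simp
      · refine Finset.sum_congr rfl fun j _ => ?_
        rw [Fin.val_succ, pow_succ]; ring
    have h0 : r 0 = 0 ∧ s 0 = 0 := by
      refine eq_zero_of_X_sub_C_pow_card_dvd hg ha hc (hr 0) (hs 0) ?_
      rw [eq_neg_of_add_eq_zero_left hsplit]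
      exact (dvd_mul_right _ _).neg_right
    rw [h0.1, h0.2, zero_mul, add_zero, zero_add] at hsplit
    have hrec := ih (fun j => r j.succ) (fun j => s j.succ) (fun j => hr _) (fun j => hs _)
      ((mul_eq_zero.mp hsplit).resolve_left hY)
    exact fun j => Fin.cases h0 hrec j

open Polynomial in
/-- Linear algebra step of Stepanov's method. -/
theorem Polynomial.exists_ne_zero_forall_sum_eq_zero {F : Type*} [Field F] (M J e D : ℕ)
    (hdim : M * D < 2 * e * J) (T U : Fin M → F[X] →ₗ[F] F[X]) (Y : F[X])
    (hT : ∀ (k : Fin M) (j : Fin J) (r : F[X]),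
      r.natDegree ≤ e - 1 → (T k r * Y ^ (j : ℕ)).natDegree < D)
    (hU : ∀ (k : Fin M) (j : Fin J) (r : F[X]),
      r.natDegree ≤ e - 1 → (U k r * Y ^ (j : ℕ)).natDegree < D) :
    ∃ r s : Fin J → F[X], (∀ j, (r j).natDegree ≤ e - 1) ∧ (∀ j, (s j).natDegree ≤ e - 1) ∧
      (∃ j, ¬ (r j = 0 ∧ s j = 0)) ∧
      ∀ k, ∑ j, (T k (r j) + U k (s j)) * Y ^ (j : ℕ) = 0 := by
  classical
  have hdeg : ∀ p : degreeLT F e, (p : F[X]).natDegree ≤ e - 1 := by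
    rintro ⟨p, hp⟩
    rw [mem_degreeLT] at hp
    rcases eq_or_ne p 0 with rfl | h0
    · simp
    · have := (natDegree_lt_iff_degree_lt h0).mpr hp
      exact Nat.le_sub_one_of_lt this
  let Ψ : Fin M → ((Fin J → degreeLT F e × degreeLT F e) →ₗ[F] F[X]) := fun k =>
    ∑ j : Fin J, LinearMap.mulRight F (Y ^ (j : ℕ)) ∘ₗ
      ((T k ∘ₗ (degreeLT F e).subtype).coprod (U k ∘ₗ (degreeLT F e).subtype)) ∘ₗ
        LinearMap.proj j
  have hΨ : ∀ k v, Ψ k v = ∑ j, (T k ((v j).1 : F[X]) + U k ((v j).2 : F[X])) * Y ^ (j : ℕ) := by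
    intro k v
    simp [Ψ]
  let Φ : (Fin J → degreeLT F e × degreeLT F e) →ₗ[F] (Fin M → Fin D → F) :=
    LinearMap.pi fun k => LinearMap.pi fun i => lcoeff F (i : ℕ) ∘ₗ Ψ k
  have hfr : Module.finrank F (degreeLT F e) = e := by
    rw [(degreeLTEquiv F e).finrank_eq, Module.finrank_fin_fun]
  have : Module.Finite F (degreeLT F e) := Module.Finite.equiv (degreeLTEquiv F e).symm
  have hker : LinearMap.ker Φ ≠ ⊥ := by
    apply LinearMap.ker_ne_bot_of_finrank_lt
    have h1 : Module.finrank F (Fin M → Fin D → F) = M * D := by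
      simp [Module.finrank_pi_fintype]
    have h2 : Module.finrank F (Fin J → degreeLT F e × degreeLT F e) = J * (e + e) := by
      rw [Module.finrank_pi_fintype]
      simp [Module.finrank_prod, hfr]
    rw [h1, h2]
    linarith
  obtain ⟨v, hv, hv0⟩ := (Submodule.ne_bot_iff _).mp hker
  refine ⟨fun j => (v j).1, fun j => (v j).2, fun j => hdeg _, fun j => hdeg _, ?_, fun k => ?_⟩
  · obtain ⟨i, hi⟩ := Function.ne_iff.mp hv0
    exact ⟨i, fun hcon => hi (Prod.ext (Subtype.ext hcon.1) (Subtype.ext hcon.2))⟩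
  · rw [← hΨ]
    ext i
    rw [coeff_zero]
    by_cases hi : i < D
    · have := congrFun (congrFun (LinearMap.mem_ker.mp hv) k) ⟨i, hi⟩
      simpa [Φ] using this
    · refine coeff_eq_zero_of_natDegree_lt (lt_of_lt_of_le ?_ (not_lt.mp hi))
      have hD : 0 < D := by
        obtain ⟨j, -⟩ := Function.ne_iff.mp hv0
        exact Nat.zero_lt_of_lt (hT k j 0 (by simp))
      rw [hΨ]
      have : (∑ j, (T k ((v j).1 : F[X]) + U k ((v j).2 : F[X])) * Y ^ (j : ℕ)).natDegree
          ≤ D - 1 := by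
        refine natDegree_sum_le_of_forall_le _ _ fun j _ => ?_
        rw [add_mul]
        refine (natDegree_add_le _ _).trans (max_le ?_ ?_)
        · exact Nat.le_sub_one_of_lt (hT k j _ (hdeg _))
        · exact Nat.le_sub_one_of_lt (hU k j _ (hdeg _))
      omega

open Polynomial in
/-- Stepanov's bound with explicit parameters. -/
theorem FiniteField.card_mul_le_of_eval_pow_eq {F : Type*} [Field F] [Fintype F]
    {f : F[X]} {a b c : F} {g : ℕ} (hg : 2 * g + 1 = Fintype.card F)
    (ha : f.rootMultiplicity a = 1) (hc : f.eval c ≠ 0) {M J e : ℕ}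
    (he : 0 < e) (hM : M ≤ Fintype.card F)
    (hed : 2 * e + f.natDegree ≤ Fintype.card F)
    (hdim : M * (M * f.natDegree + e + J) < 2 * e * J) (A : Finset F)
    (hA : ∀ x ∈ A, (f.eval x) ^ g = b) :
    A.card * M ≤ M * f.natDegree + e + g * f.natDegree + Fintype.card F * J := by
  have hf : f ≠ 0 := by rintro rfl; simp at hc
  choose T hT hTd using fun k : Fin M =>
    exists_linearMap_hasseDeriv_pow_mul hf (N := M) (k := k) k.2.le
  choose U hU hUd using fun k : Fin M =>
    exists_linearMap_hasseDeriv_pow_mul hf (N := M + g) (k := k) (k.2.le.trans (by omega))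
  have hbound : ∀ (k : Fin M) (j : Fin J) (r p : F[X]), r.natDegree ≤ e - 1 →
      p.natDegree ≤ k * f.natDegree + r.natDegree →
      (p * (X - C c) ^ (j : ℕ)).natDegree < M * f.natDegree + e + J := by
    intro k j r p hr hp
    refine natDegree_mul_le.trans_lt ?_
    rw [natDegree_pow, natDegree_X_sub_C, mul_one]
    have := Nat.mul_le_mul_right f.natDegree k.2.le
    have := j.2
    omega
  obtain ⟨r, s, hr, hs, ⟨j₀, hj₀⟩, hsum⟩ := exists_ne_zero_forall_sum_eq_zero M J e
    (M * f.natDegree + e + J) hdim T (fun k => b • U k) (X - C c)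
    (fun k j p hp => hbound k j p _ hp (hTd k p))
    (fun k j p hp => hbound k j p _ hp ((natDegree_smul_le _ _).trans (hUd k p)))
  set q := Fintype.card F with hq
  set S := ∑ j, (r j + s j * f ^ g) * ((X - C c) ^ q) ^ (j : ℕ) with hS
  have hS0 : S ≠ 0 := fun h0 => hj₀ (eq_zero_of_sum_mul_X_sub_C_pow_eq_zero hg ha hc J r s
    (fun j => by have := hr j; omega) (fun j => by have := hs j; omega) h0 j₀)
  have hdvd : ∀ x ∈ A, (X - C x) ^ M ∣ f ^ M * S := by
    intro x hx
    have hmod : (X - C x) ^ M ∣ (X - C c) ^ q - C (x - c) := by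
      have : (X - C c) ^ q - C (x - c) = (X - C x) ^ q := by
        rw [polynomial_sub_C_pow_card, polynomial_sub_C_pow_card, C_sub]
        ring
      rw [this]
      exact pow_dvd_pow _ hM
    set S' := ∑ j, (r j + s j * f ^ g) * (C (x - c)) ^ (j : ℕ) with hS'
    have hSS' : (X - C x) ^ M ∣ f ^ M * S - f ^ M * S' := by
      rw [← mul_sub, hS, hS', ← Finset.sum_sub_distrib]
      refine (Finset.dvd_sum fun j _ => ?_).mul_left _
      rw [← mul_sub]
      exact (hmod.trans (sub_dvd_pow_sub_pow _ _ _)).mul_left _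
    refine (dvd_iff_dvd_of_dvd_sub hSS').mpr ?_
    refine X_sub_C_pow_dvd_of_eval_hasseDeriv fun k hk => ?_
    have hfS' : f ^ M * S' = ∑ j : Fin J, ((x - c) ^ (j : ℕ) • (f ^ M * r j) +
        (x - c) ^ (j : ℕ) • (f ^ (M + g) * s j)) := by
      rw [hS', Finset.mul_sum]
      refine Finset.sum_congr rfl fun j _ => ?_
      rw [smul_eq_C_mul, smul_eq_C_mul, C_pow, pow_add]
      ring
    have hev := congrArg (eval x) (hsum ⟨k, hk⟩)
    have hMk : M + g - k = M - k + g := by omega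
    rw [hfS', map_sum, eval_finsetSum, ← mul_zero ((f.eval x) ^ (M - k)), ← eval_zero (x := x),
      ← hev, eval_finsetSum, Finset.mul_sum]
    refine Finset.sum_congr rfl fun j _ => ?_
    rw [map_add, map_smul, map_smul, hT ⟨k, hk⟩, hU ⟨k, hk⟩]
    simp only [eval_add, eval_smul, eval_mul, eval_pow, eval_sub, eval_X, eval_C,
      LinearMap.smul_apply, smul_eq_mul, hMk, pow_add, hA x hx]
    ring
  have hcard := card_mul_le_natDegree_of_X_sub_C_pow_dvd
    (mul_ne_zero (pow_ne_zero M hf) hS0) A M hdvd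
  refine hcard.trans (natDegree_mul_le.trans ?_)
  rw [natDegree_pow]
  have hSd : S.natDegree ≤ e + g * f.natDegree + q * J := by
    refine natDegree_sum_le_of_forall_le _ _ fun j _ => natDegree_mul_le.trans ?_
    have h1 : (((X - C c) ^ q) ^ (j : ℕ)).natDegree ≤ q * J := by
      rw [← pow_mul, natDegree_pow, natDegree_X_sub_C, mul_one]
      exact Nat.mul_le_mul_left _ j.2.le
    have h2 : (r j + s j * f ^ g).natDegree ≤ e + g * f.natDegree := by
      refine (natDegree_add_le _ _).trans (max_le ?_ (natDegree_mul_le.trans ?_))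
      · have := hr j; omega
      · rw [natDegree_pow]; have := hs j; omega
    omega
  omega

open Polynomial in
/-- A bound of the form `o(|F|)` for quadratic character sums over polynomials with a simple
root. -/
theorem FiniteField.abs_sum_quadraticChar_eval_le {F : Type*} [Field F] [Fintype F]
    [DecidableEq F] (hF : ringChar F ≠ 2) {f : F[X]} {a : F} (ha : f.rootMultiplicity a = 1)
    {d K : ℕ} (hfd : f.natDegree ≤ d) (hK : 0 < K)
    (hq : 2 * (K * (2 * K * d + K + 1)) + d + 3 ≤ Fintype.card F) :
    2 * K * |∑ x, quadraticChar F (f.eval x)| ≤ 6 * K * d + Fintype.card F * (d + 3) := by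
  have hf : f ≠ 0 := by rintro rfl; simp at ha
  set q := Fintype.card F with hqdef
  have hg : 2 * (q / 2) + 1 = q := by
    have := FiniteField.odd_card_of_char_ne_two hF
    omega
  obtain ⟨c, hc⟩ : ∃ c, f.eval c ≠ 0 := by
    by_contra! h
    refine hf (eq_zero_of_natDegree_lt_card_of_eval_eq_zero' f Finset.univ (fun x _ => h x) ?_)
    rw [Finset.card_univ]
    omega
  have hcard : ∀ b : ℤ, 4 * K * ((Finset.univ.filter
      fun x => quadraticChar F (f.eval x) = b).card : ℤ) ≤ 2 * K * q + 4 * K * d + q * (d + 3) := by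
    intro b
    set A := Finset.univ.filter fun x => quadraticChar F (f.eval x) = b with hAdef
    set e := (q - d) / 2 with he
    have heX : K * (2 * K * d + K + 1) < e := by omega
    have hKK : K ≤ K * (2 * K * d + K + 1) := Nat.le_mul_of_pos_right _ (by omega)
    have h := card_mul_le_of_eval_pow_eq (M := 2 * K) (J := K + 1) (e := e) (b := (b : F)) hg ha hc
      (by omega) (by omega) (by omega)
      (by
        have : 2 * K * (2 * K * f.natDegree + e + (K + 1)) ≤
            2 * K * (2 * K * d + e + (K + 1)) := by gcongr
        refine this.trans_lt ?_
        linarith) A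
      (by
        intro x hx
        rw [← quadraticChar_eq_pow_of_char_ne_two' hF, (Finset.mem_filter.mp hx).2])
    have h1 : 2 * K * f.natDegree ≤ 2 * K * d := by gcongr
    have h2 : (q / 2) * f.natDegree ≤ (q / 2) * d := by gcongr
    have h3 : 2 * ((q / 2) * d) ≤ q * d := by
      rw [← mul_assoc]
      exact Nat.mul_le_mul_right _ (Nat.mul_div_le q 2)
    have h4 : 2 * e ≤ q := by omega
    have h5 : 4 * K * A.card ≤ 2 * K * q + 4 * K * d + q * (d + 3) := by linarith
    exact_mod_cast h5
  have hzero : ((Finset.univ.filter fun x => f.eval x = 0).card : ℤ) ≤ d := by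
    have h : (Finset.univ.filter fun x => f.eval x = 0).card ≤ f.natDegree :=
      card_le_degree_of_subset_roots fun x hx => by simpa [hf] using hx
    exact_mod_cast h.trans hfd
  have hval : ∀ x, quadraticChar F (f.eval x) = (if quadraticChar F (f.eval x) = 1 then 1 else 0) -
      (if quadraticChar F (f.eval x) = -1 then 1 else 0) ∧
      (1 : ℤ) = (if quadraticChar F (f.eval x) = 1 then 1 else 0) +
      (if quadraticChar F (f.eval x) = -1 then 1 else 0) + if f.eval x = 0 then 1 else 0 := by
    intro x
    by_cases h : f.eval x = 0
    · simp [h]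
    · rcases quadraticChar_dichotomy h with h' | h' <;> simp [h, h']
  have hS : ∑ x, quadraticChar F (f.eval x) =
      ((Finset.univ.filter fun x => quadraticChar F (f.eval x) = 1).card : ℤ) -
      (Finset.univ.filter fun x => quadraticChar F (f.eval x) = -1).card := by
    rw [Finset.sum_congr rfl fun x _ => (hval x).1, Finset.sum_sub_distrib, Finset.sum_boole,
      Finset.sum_boole]
  have hone : (q : ℤ) = ((Finset.univ.filter fun x => quadraticChar F (f.eval x) = 1).card : ℤ) +
      (Finset.univ.filter fun x => quadraticChar F (f.eval x) = -1).card +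
      (Finset.univ.filter fun x => f.eval x = 0).card := by
    have : (q : ℤ) = ∑ x : F, (1 : ℤ) := by simp [hqdef]
    rw [this, Finset.sum_congr rfl fun x _ => (hval x).2, Finset.sum_add_distrib,
      Finset.sum_add_distrib, Finset.sum_boole, Finset.sum_boole, Finset.sum_boole]
  have hp := hcard 1
  have hm := hcard (-1)
  have hKz : 2 * (K : ℤ) * (Finset.univ.filter fun x => f.eval x = 0).card ≤ 2 * K * d := by gcongr
  have hpos : (0 : ℤ) < 2 * K := by positivity
  have hK1 := congrArg (fun t : ℤ => 2 * K * t) hone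
  rw [← abs_of_pos hpos, ← abs_mul, hS, abs_le]
  constructor <;> linarith

open Polynomial in
theorem Polynomial.rootMultiplicity_prod_linear {F ι : Type*} [Field F] [DecidableEq ι]
    {α β : ι → F} (hα : ∀ i, α i ≠ 0) (hαβ : ∀ i j, i ≠ j → α i * β j - α j * β i ≠ 0)
    {T : Finset ι} {i : ι} (hi : i ∈ T) :
    (∏ j ∈ T, (C (α j) * X + C (β j))).rootMultiplicity (-(β i / α i)) = 1 := by
  have hroot : ∀ j, (C (α j) * X + C (β j)).eval (-(β i / α i)) =
      (α i * β j - α j * β i) / α i := by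
    intro j
    have := hα i
    simp only [eval_add, eval_mul, eval_C, eval_X]
    field_simp
    ring
  have hne : ∏ j ∈ T.erase i, (C (α j) * X + C (β j)) ≠ 0 := by
    refine Finset.prod_ne_zero_iff.mpr fun j _ h => hα j ?_
    simpa using congrArg (fun p => p.coeff 1) h
  have hlin : C (α i) * X + C (β i) = C (α i) * (X - C (-(β i / α i))) := by
    rw [mul_sub, ← C_mul, mul_neg, mul_div_cancel₀ _ (hα i), C_neg, sub_neg_eq_add]
  have hCa : (C (α i) : F[X]) ≠ 0 := C_ne_zero.mpr (hα i)
  have hX := X_sub_C_ne_zero (-(β i / α i))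
  rw [← Finset.mul_prod_erase T _ hi, rootMultiplicity_mul (by
      rw [hlin]; exact mul_ne_zero (mul_ne_zero hCa hX) hne), hlin,
    rootMultiplicity_mul (mul_ne_zero hCa hX), rootMultiplicity_C, rootMultiplicity_X_sub_C_self,
    rootMultiplicity_eq_zero]
  rw [IsRoot.def, eval_prod, Finset.prod_eq_zero_iff]
  rintro ⟨j, hj, h0⟩
  rw [hroot] at h0
  exact div_ne_zero (hαβ i j (Finset.ne_of_mem_erase hj).symm) (hα i) h0

theorem exists_forall_mul_add_ne_zero {F : Type*} [Field F] [Fintype F] {n : ℕ}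
    (hn : n < Fintype.card F) {α β : Fin n → F} (hα : ∀ i, α i ≠ 0) :
    ∃ x, ∀ i, α i * x + β i ≠ 0 := by
  classical
  obtain ⟨x, hx⟩ : ∃ x, x ∉ Finset.univ.image fun i => -(β i / α i) := by
    by_contra! h
    have h1 : Fintype.card F ≤ (Finset.univ.image fun i => -(β i / α i)).card :=
      Finset.card_le_card fun x _ => h x
    have h2 := (h1.trans Finset.card_image_le)
    simp at h2
    omega
  refine ⟨x, fun i hi => hx (Finset.mem_image.mpr ⟨i, Finset.mem_univ _, ?_⟩)⟩
  have := hα i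
  field_simp
  linear_combination -hi

open Polynomial in
theorem FiniteField.exists_forall_quadraticChar_mul_eq_one {F : Type*} [Field F] [Fintype F]
    [DecidableEq F] (hF : ringChar F ≠ 2) {n K : ℕ} (hK : K = 2 ^ (n + 1) * (n + 3))
    (hq : 2 * (K * (2 * K * n + K + 1)) + n + 3 ≤ Fintype.card F)
    (hq' : 16 * (n * 2 ^ n) < Fintype.card F) {α β : Fin n → F} (hα : ∀ i, α i ≠ 0)
    (hαβ : ∀ i j, i ≠ j → α i * β j - α j * β i ≠ 0) {ε : Fin n → F} (hε : ∀ i, ε i ≠ 0) :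
    ∃ x, ∀ i, quadraticChar F (ε i) * quadraticChar F (α i * x + β i) = 1 := by
  by_contra! hcon
  set q := Fintype.card F with hqdef
  set W : ℤ := ∑ x, ∏ i, (1 + quadraticChar F (ε i) * quadraticChar F (α i * x + β i)) with hW
  have hupper : W ≤ n * 2 ^ n := by
    have hpt : ∀ x, ∏ i, (1 + quadraticChar F (ε i) * quadraticChar F (α i * x + β i)) ≤
        ∑ i, if α i * x + β i = 0 then (2 : ℤ) ^ n else 0 := by
      intro x
      have hnn : ∀ i, (0 : ℤ) ≤ if α i * x + β i = 0 then (2 : ℤ) ^ n else 0 := fun i => by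
        split_ifs <;> positivity
      obtain ⟨i, hi⟩ := hcon x
      by_cases hx : ∃ j, α j * x + β j = 0
      · obtain ⟨j, hj⟩ := hx
        refine le_trans ?_ (Finset.single_le_sum (fun i _ => hnn i) (Finset.mem_univ j))
        rw [if_pos hj]
        have h2 : ∀ i, 0 ≤ 1 + quadraticChar F (ε i) * quadraticChar F (α i * x + β i) ∧
            1 + quadraticChar F (ε i) * quadraticChar F (α i * x + β i) ≤ 2 := by
          intro i
          by_cases h0 : α i * x + β i = 0
          · simp [h0]
          · rcases quadraticChar_dichotomy (hε i) with h | h <;>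
              rcases quadraticChar_dichotomy h0 with h' | h' <;> simp [h, h']
        refine (Finset.prod_le_prod (fun i _ => (h2 i).1) fun i _ => (h2 i).2).trans ?_
        simp
      · push Not at hx
        refine le_trans (le_of_eq (Finset.prod_eq_zero (Finset.mem_univ i) ?_))
          (Finset.sum_nonneg fun i _ => hnn i)
        rcases quadraticChar_dichotomy (hε i) with h | h <;>
          rcases quadraticChar_dichotomy (hx i) with h' | h' <;> simp_all
    refine (Finset.sum_le_sum fun x _ => hpt x).trans ?_
    rw [Finset.sum_comm]
    have hone : ∀ i : Fin n, (∑ x, if α i * x + β i = 0 then (2 : ℤ) ^ n else 0) = 2 ^ n := by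
      intro i
      have hiff : ∀ x, α i * x + β i = 0 ↔ x = -(β i / α i) := by
        intro x
        have := hα i
        rw [eq_neg_iff_add_eq_zero, ← mul_eq_zero_iff_left this (b := x + β i / α i), mul_add,
          mul_div_cancel₀ _ this]
      simp [hiff]
    simp [hone]
  have hexp : W = ∑ T : Finset (Fin n), (∏ i ∈ T, quadraticChar F (ε i)) *
      ∑ x, quadraticChar F ((∏ i ∈ T, (C (α i) * X + C (β i))).eval x) := by
    rw [hW, Finset.sum_congr rfl fun x _ => Finset.prod_one_add Finset.univ, Finset.sum_comm,
      Finset.powerset_univ]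
    refine Finset.sum_congr rfl fun T _ => ?_
    rw [Finset.mul_sum]
    refine Finset.sum_congr rfl fun x _ => ?_
    rw [Finset.prod_mul_distrib, eval_prod, map_prod]
    simp
  have hterm : ∀ T : Finset (Fin n), T ≠ ∅ → 2 * 2 ^ (n + 1) *
      |(∏ i ∈ T, quadraticChar F (ε i)) *
        ∑ x, quadraticChar F ((∏ i ∈ T, (C (α i) * X + C (β i))).eval x)| ≤
      6 * 2 ^ (n + 1) * n + q := by
    intro T hT
    obtain ⟨i, hi⟩ := Finset.nonempty_iff_ne_empty.mpr hT
    have hdeg : (∏ i ∈ T, (C (α i) * X + C (β i))).natDegree ≤ n := by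
      refine (natDegree_prod_le _ _).trans ?_
      refine (Finset.sum_le_card_nsmul T _ 1 fun i _ => natDegree_linear_le).trans ?_
      simpa using Finset.card_le_univ T
    have hKpos : 0 < K := by rw [hK]; positivity
    have h := abs_sum_quadraticChar_eval_le hF (rootMultiplicity_prod_linear hα hαβ hi) hdeg
      hKpos hq
    have habs : |∏ i ∈ T, quadraticChar F (ε i)| = 1 := by
      rw [Finset.abs_prod]
      refine Finset.prod_eq_one fun i _ => ?_
      rcases quadraticChar_dichotomy (hε i) with h | h <;> simp [h]
    rw [abs_mul, habs, one_mul]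
    have hn3 : (0 : ℤ) < n + 3 := by positivity
    refine le_of_mul_le_mul_right ?_ hn3
    rw [hK] at h
    push_cast at h
    rw [← hqdef] at h
    linarith
  have hempty : (∏ i ∈ (∅ : Finset (Fin n)), quadraticChar F (ε i)) *
      ∑ x, quadraticChar F ((∏ i ∈ (∅ : Finset (Fin n)), (C (α i) * X + C (β i))).eval x) = q := by
    simp [hqdef]
  rw [← Finset.add_sum_erase _ _ (Finset.mem_univ ∅), hempty] at hexp
  set R := ∑ T ∈ Finset.univ.erase (∅ : Finset (Fin n)), (∏ i ∈ T, quadraticChar F (ε i)) *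
      ∑ x, quadraticChar F ((∏ i ∈ T, (C (α i) * X + C (β i))).eval x) with hR
  have hRle : 2 * 2 ^ (n + 1) * |R| ≤ 2 ^ n * (6 * 2 ^ (n + 1) * n + q) := by
    have h1 : 2 * 2 ^ (n + 1) * |R| ≤ ∑ T ∈ Finset.univ.erase (∅ : Finset (Fin n)),
        (6 * 2 ^ (n + 1) * n + q : ℤ) := by
      refine (mul_le_mul_of_nonneg_left (Finset.abs_sum_le_sum_abs _ _) (by positivity)).trans ?_
      rw [Finset.mul_sum]
      exact Finset.sum_le_sum fun T hT => hterm T (Finset.ne_of_mem_erase hT)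
    refine h1.trans ((Finset.sum_le_sum_of_subset_of_nonneg (Finset.erase_subset _ _)
      fun _ _ _ => by positivity).trans ?_)
    simp
  have hRle' : 4 * |R| ≤ 12 * (n * 2 ^ n) + q := by
    have h2 : (0 : ℤ) < 2 ^ n := by positivity
    refine le_of_mul_le_mul_left ?_ h2
    rw [pow_succ] at hRle
    linarith
  have hRneg := neg_abs_le R
  have hq'' : 16 * ((n : ℤ) * 2 ^ n) < q := by exact_mod_cast hq'
  linarith

/-- For every integer `n ≥ 1` there exists a real bound `B > 0` such that
for every finite field `F` of cardinality greater than `B`, and all nonzero `α₁, …, αₙ ∈ F`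
and `β₁, …, βₙ ∈ F` with `αᵢβⱼ - αⱼβᵢ ≠ 0` for all `i ≠ j`, and all nonzero
`ε₁, …, εₙ ∈ F`, there exist `μ ∈ F` and nonzero `z₁, …, zₙ ∈ F` with
`αᵢ μ + βᵢ = εᵢ zᵢ²` for all `i`. -/
theorem finite_field_simultaneous_square_values (n : ℕ) (hn : 1 ≤ n) :
    ∃ B : ℝ, 0 < B ∧
      ∀ (F : Type) [Field F] [Fintype F], B < (Fintype.card F : ℝ) →
        ∀ (α β : Fin n → F), (∀ i, α i ≠ 0) →
          (∀ i j, i ≠ j → α i * β j - α j * β i ≠ 0) →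
          ∀ ε : Fin n → F, (∀ i, ε i ≠ 0) →
            ∃ (μ : F) (z : Fin n → F), (∀ i, z i ≠ 0) ∧
              ∀ i, α i * μ + β i = ε i * z i ^ 2 := by
  classical
  set K := 2 ^ (n + 1) * (n + 3) with hK
  refine ⟨((2 * (K * (2 * K * n + K + 1)) + n + 3 + 16 * (n * 2 ^ n) : ℕ) : ℝ),
    Nat.cast_pos.mpr (by omega), ?_⟩
  intro F _ _ hB α β hα hαβ ε hε
  have hq := Nat.cast_lt.mp hB
  suffices h : ∃ μ, ∀ i, α i * μ + β i ≠ 0 ∧ IsSquare (ε i * (α i * μ + β i)) by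
    obtain ⟨μ, hμ⟩ := h
    choose w hw using fun i => (hμ i).2
    have hw0 : ∀ i, w i ≠ 0 := fun i h0 =>
      mul_ne_zero (hε i) (hμ i).1 (by rw [hw i, h0, mul_zero])
    refine ⟨μ, fun i => w i / ε i, fun i => div_ne_zero (hw0 i) (hε i), fun i => ?_⟩
    have := hε i
    field_simp
    linear_combination hw i
  by_cases hF : ringChar F = 2
  · obtain ⟨μ, hμ⟩ := exists_forall_mul_add_ne_zero (β := β) (by omega) hα
    exact ⟨μ, fun i => ⟨hμ i, FiniteField.isSquare_of_char_two hF _⟩⟩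
  · obtain ⟨μ, hμ⟩ := FiniteField.exists_forall_quadraticChar_mul_eq_one hF hK (by omega)
      (by omega) hα hαβ hε
    have h0 : ∀ i, α i * μ + β i ≠ 0 := fun i h => by simpa [h] using hμ i
    refine ⟨μ, fun i => ⟨h0 i, ?_⟩⟩
    rw [← quadraticChar_one_iff_isSquare (mul_ne_zero (hε i) (h0 i)), map_mul, hμ i]
end

section
/- Let K be a number field with ring of integers O_K, let g ≥ 1 be an integer, and let a₁, …, a_{2g+1}, ρ, κ, m, λ, μ₀, μ₁ ∈ O_K with ρ, κ, m all nonzero. Define the 2g + 2 affine linear forms Lᵢ ∈ O_K[X, Y] by Lᵢ(X, Y) = ρ²κ(mX + μ₁) − aᵢρ²κ(ρ²κ(mY + μ₀) + λ) + 1 for 1 ≤ i ≤ 2g + 1, and L_{2g+2}(X, Y) = ρ²κ(mY + μ₀) + λ. Assume: (i) λ ≡ 1 modulo the ideal ρO_K; (ii) the ideal generated by λ and κ is all of O_K; (iii) for every nonzero prime ideal 𝔭 of O_K dividing the ideal mO_K, none of the 2g + 2 elements ρ²κμ₁ − aᵢρ⁴κ²μ₀ − aᵢρ²κλ + 1 (for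 1 ≤ i ≤ 2g + 1) and ρ²κμ₀ + λ lies in 𝔭; (iv) every nonzero prime ideal 𝔭 of O_K not containing ρκm has residue field O_K/𝔭 of cardinality strictly greater than 2g + 1. Then for every nonzero prime ideal 𝔭 of O_K there exist u, v ∈ O_K such that Lᵢ(u, v) ∉ 𝔭 for all 1 ≤ i ≤ 2g + 2 (i.e. the forms are admissible: there is no local obstruction at any prime to representing elements coprime to 𝔭). -/
open NumberField

/-- Finitely many residue classes modulo an ideal do not exhaust a larger quotient. -/
theorem exists_forall_sub_notMem_of_lt_card_quotient {R : Type*} [CommRing R] (I : Ideal R)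
    {n : ℕ} (h : n < Nat.card (R ⧸ I)) (d : Fin n → R) : ∃ t : R, ∀ i, t - d i ∉ I := by
  by_contra! H
  have hsurj : Function.Surjective fun i => Ideal.Quotient.mk I (d i) := by
    intro x
    obtain ⟨t, rfl⟩ := Ideal.Quotient.mk_surjective x
    obtain ⟨i, hi⟩ := H t
    exact ⟨i, (Ideal.Quotient.eq.mpr hi).symm⟩
  have hle := Nat.card_le_card_of_surjective _ hsurj
  rw [Nat.card_fin] at hle
  exact hle.not_gt h

/-- Modulo a maximal ideal, every linear congruence with invertible leading coefficient is
solvable. -/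
theorem Ideal.IsMaximal.exists_mul_sub_mem {R : Type*} [CommRing R] {I : Ideal R}
    (hI : I.IsMaximal) {c : R} (hc : c ∉ I) (b : R) : ∃ x : R, c * x - b ∈ I := by
  obtain ⟨w, k, hk, hw⟩ := hI.exists_inv hc
  refine ⟨w * b, ?_⟩
  rw [show c * (w * b) - b = -b * k by linear_combination b * hw]
  exact I.mul_mem_left _ hk

/-- (Admissibility of the affine linear forms.) Let `K` be a number field
with ring of integers `O_K`, `g ≥ 1`, and `a₁, …, a_{2g+1}, ρ, κ, m, λ, μ₀, μ₁ ∈ O_K` with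
`ρ, κ, m` nonzero. Let `Lᵢ(X, Y) = ρ²κ(mX + μ₁) - aᵢρ²κ(ρ²κ(mY + μ₀) + λ) + 1` for
`1 ≤ i ≤ 2g + 1` and `L_{2g+2}(X, Y) = ρ²κ(mY + μ₀) + λ`. Assume:
(i) `λ ≡ 1 mod ρO_K`; (ii) `(λ, κ) = O_K`; (iii) for every nonzero prime `𝔭 ∣ mO_K`, none of
the `2g + 2` elements `ρ²κμ₁ - aᵢρ⁴κ²μ₀ - aᵢρ²κλ + 1` and `ρ²κμ₀ + λ` lies in `𝔭`;
(iv) every nonzero prime `𝔭` with `ρκm ∉ 𝔭` has residue field of cardinality `> 2g + 1`.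
Then for every nonzero prime `𝔭` there exist `u, v ∈ O_K` with `Lᵢ(u, v) ∉ 𝔭` for all `i`. -/
theorem admissible_linear_forms
    (K : Type) [Field K] [NumberField K] (g : ℕ) (hg : 1 ≤ g)
    (a : Fin (2 * g + 1) → 𝓞 K) (ρ κ m lam μ₀ μ₁ : 𝓞 K)
    (hρ : ρ ≠ 0) (hκ : κ ≠ 0) (hm : m ≠ 0)
    (L : Fin (2 * g + 2) → 𝓞 K → 𝓞 K → 𝓞 K)
    (hL : ∀ (i : Fin (2 * g + 1)) (X Y : 𝓞 K),
      L i.castSucc X Y =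
        ρ ^ 2 * κ * (m * X + μ₁) - a i * ρ ^ 2 * κ * (ρ ^ 2 * κ * (m * Y + μ₀) + lam) + 1)
    (hLlast : ∀ X Y : 𝓞 K, L (Fin.last (2 * g + 1)) X Y = ρ ^ 2 * κ * (m * Y + μ₀) + lam)
    (h1 : lam - 1 ∈ Ideal.span {ρ})
    (h2 : Ideal.span {lam, κ} = (⊤ : Ideal (𝓞 K)))
    (h3 : ∀ 𝔭 : Ideal (𝓞 K), 𝔭.IsPrime → 𝔭 ≠ ⊥ → m ∈ 𝔭 →
      (∀ i : Fin (2 * g + 1),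
        ρ ^ 2 * κ * μ₁ - a i * ρ ^ 4 * κ ^ 2 * μ₀ - a i * ρ ^ 2 * κ * lam + 1 ∉ 𝔭) ∧
      ρ ^ 2 * κ * μ₀ + lam ∉ 𝔭)
    (h4 : ∀ 𝔭 : Ideal (𝓞 K), 𝔭.IsPrime → 𝔭 ≠ ⊥ → ρ * κ * m ∉ 𝔭 →
      2 * g + 1 < Nat.card (𝓞 K ⧸ 𝔭)) :
    ∀ 𝔭 : Ideal (𝓞 K), 𝔭.IsPrime → 𝔭 ≠ ⊥ →
      ∃ u v : 𝓞 K, ∀ i : Fin (2 * g + 2), L i u v ∉ 𝔭 := by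
  intro 𝔭 hp hp0
  have hone : (1 : 𝓞 K) ∉ 𝔭 := (Ideal.ne_top_iff_one 𝔭).mp hp.ne_top
  by_cases hm𝔭 : m ∈ 𝔭
  · obtain ⟨hi, hlast⟩ := h3 𝔭 hp hp0 hm𝔭
    refine ⟨0, 0, Fin.lastCases ?_ fun i => ?_⟩
    · rw [hLlast]
      convert hlast using 2
      ring
    · rw [hL]
      convert hi i using 2
      ring
  by_cases hρκ : ρ * κ ∈ 𝔭
  · have hlam : lam ∉ 𝔭 := by
      intro hlam
      rcases hp.mem_or_mem hρκ with hρ𝔭 | hκ𝔭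
      · have hsub := (Ideal.span_singleton_le_iff_mem 𝔭).mpr hρ𝔭 h1
        exact hone (by simpa using 𝔭.sub_mem hlam hsub)
      · exact hp.ne_top (top_le_iff.mp (h2 ▸ Ideal.span_le.mpr (by
          rintro x (rfl | rfl) <;> assumption)))
    refine ⟨0, 0, Fin.lastCases ?_ fun i => ?_⟩
    · rw [hLlast]
      rwa [show ρ ^ 2 * κ * (m * 0 + μ₀) + lam = ρ * μ₀ * (ρ * κ) + lam by ring,
        𝔭.add_mem_iff_right (𝔭.mul_mem_left _ hρκ)]
    · rw [hL]
      rwa [show ρ ^ 2 * κ * (m * 0 + μ₁)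
            - a i * ρ ^ 2 * κ * (ρ ^ 2 * κ * (m * 0 + μ₀) + lam) + 1
          = (ρ * μ₁ - a i * ρ * (ρ ^ 2 * κ * μ₀ + lam)) * (ρ * κ) + 1 by ring,
        𝔭.add_mem_iff_right (𝔭.mul_mem_left _ hρκ)]
  have hprod : ρ * κ * m ∉ 𝔭 := hp.mul_notMem hρκ hm𝔭
  have hc : ρ ^ 2 * κ * m ∉ 𝔭 := by
    rw [show ρ ^ 2 * κ * m = ρ * (ρ * κ * m) by ring]
    exact hp.mul_notMem (fun h => hρκ (𝔭.mul_mem_right _ h)) hprod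
  have hmax : 𝔭.IsMaximal := hp.isMaximal hp0
  obtain ⟨v, hv⟩ := hmax.exists_mul_sub_mem hc (1 - (ρ ^ 2 * κ * μ₀ + lam))
  obtain ⟨t, ht⟩ := exists_forall_sub_notMem_of_lt_card_quotient 𝔭 (h4 𝔭 hp hp0 hprod)
    fun i => a i * ρ ^ 2 * κ * (ρ ^ 2 * κ * (m * v + μ₀) + lam) - 1
  obtain ⟨u, hu⟩ := hmax.exists_mul_sub_mem hc (t - ρ ^ 2 * κ * μ₁)
  refine ⟨u, v, Fin.lastCases (fun hmem => hone ?_) fun i hmem => ht i ?_⟩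
  · rw [hLlast] at hmem
    convert 𝔭.sub_mem hmem hv using 1
    ring
  · rw [hL] at hmem
    convert 𝔭.sub_mem hmem hu using 1
    ring
end
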